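/- arXiv:1307.0518 — 2 statements merged into one kernel-verified Lean document; each statement's English description precedes it below -/
import Mathlib

section
/- If the integer matrix θ − I has rank 2 and det θ = −1, then there exist positive integers c₁, c₂ with c₁ ∣ c₂ and c₁·c₂ = |det(θ − I)| such that H²(G, ℤ) ≅ ℤ/c₁ ⊕ ℤ/c₂. -/
/-- The automorphism of `ℤ²` (written multiplicatively) induced by a matrix `θ ∈ GL(2, ℤ)`. -/
noncomputable def torusAut (θ : GL (Fin 2) ℤ) : MulAut (Multiplicative (Fin 2 → ℤ)) :=
  AddEquiv.toMultiplicative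
    ((LinearMap.GeneralLinearGroup.generalLinearEquiv ℤ (Fin 2 → ℤ)
      (Matrix.GeneralLinearGroup.toLin θ)).toAddEquiv)

/-- The action of `ℤ` on `ℤ²` in which the generator `1 ∈ ℤ` acts via `θ`. -/
noncomputable def torusAction (θ : GL (Fin 2) ℤ) :
    Multiplicative ℤ →* MulAut (Multiplicative (Fin 2 → ℤ)) :=
  zpowersHom _ (torusAut θ)

/-- The fundamental group `G = ℤ² ⋊_θ ℤ` of the torus bundle with monodromy `θ`. -/
noncomputable def TorusBundleGroup (θ : GL (Fin 2) ℤ) : Type :=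
  SemidirectProduct (Multiplicative (Fin 2 → ℤ)) (Multiplicative ℤ) (torusAction θ)

noncomputable instance (θ : GL (Fin 2) ℤ) : Group (TorusBundleGroup θ) :=
  inferInstanceAs (Group (SemidirectProduct _ _ _))

open Matrix
section tb
variable (θ : GL (Fin 2) ℤ)

abbrev tbm (n : ℤ) : Matrix (Fin 2) (Fin 2) ℤ := ((θ ^ n : GL (Fin 2) ℤ) : Matrix (Fin 2) (Fin 2) ℤ)

theorem torusAut_apply (x : Multiplicative (Fin 2 → ℤ)) :
    torusAut θ x = Multiplicative.ofAdd ((θ : Matrix (Fin 2) (Fin 2) ℤ) *ᵥ x.toAdd) := by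
  rfl

theorem torusAction_apply (n : ℤ) (b : Fin 2 → ℤ) :
    torusAction θ (Multiplicative.ofAdd n) (Multiplicative.ofAdd b)
      = Multiplicative.ofAdd (tbm θ n *ᵥ b) := by
  have hN : ∀ (ψ : GL (Fin 2) ℤ) , ∃ F : GL (Fin 2) ℤ →* MulAut (Multiplicative (Fin 2 → ℤ)),
      ∀ ψ, F ψ = torusAut ψ := fun _ => ⟨⟨⟨torusAut, by
        ext x; simp [torusAut_apply]⟩, by
        intro x y
        refine MulEquiv.ext fun v => ?_
        rw [MulAut.mul_apply, torusAut_apply, torusAut_apply, torusAut_apply, toAdd_ofAdd,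
          mulVec_mulVec, Units.val_mul]⟩, fun _ => rfl⟩
  obtain ⟨F, hF⟩ := hN θ
  simp only [torusAction, zpowersHom_apply, toAdd_ofAdd]
  rw [← hF, ← map_zpow, hF, torusAut_apply]
  rfl

/-- elements of the group -/
noncomputable def tbe (a : Fin 2 → ℤ) (n : ℤ) : TorusBundleGroup θ :=
  (⟨Multiplicative.ofAdd a, Multiplicative.ofAdd n⟩ :
    SemidirectProduct (Multiplicative (Fin 2 → ℤ)) (Multiplicative ℤ) (torusAction θ))

noncomputable def tbv (g : TorusBundleGroup θ) : Fin 2 → ℤ :=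
  Multiplicative.toAdd (SemidirectProduct.left (φ := torusAction θ) g)
noncomputable def tbn (g : TorusBundleGroup θ) : ℤ :=
  Multiplicative.toAdd (SemidirectProduct.right (φ := torusAction θ) g)

theorem tbe_surj (g : TorusBundleGroup θ) : g = tbe θ (tbv θ g) (tbn θ g) := rfl
@[simp] theorem tbv_tbe (a n) : tbv θ (tbe θ a n) = a := rfl
@[simp] theorem tbn_tbe (a n) : tbn θ (tbe θ a n) = n := rfl

theorem tbe_mul (a b n m) : tbe θ a n * tbe θ b m = tbe θ (a + tbm θ n *ᵥ b) (n + m) := by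
  refine SemidirectProduct.ext (φ := torusAction θ) ?_ rfl
  exact congrArg (fun x => Multiplicative.ofAdd a * x) (torusAction_apply θ n b)
theorem tbe_one : (1 : TorusBundleGroup θ) = tbe θ 0 0 := rfl

theorem tbm_zero : tbm θ 0 = 1 := by simp [tbm]
theorem tbm_add (n m) : tbm θ (n + m) = tbm θ n * tbm θ m := by
  simp only [tbm, _root_.zpow_add, Units.val_mul]

theorem exists_S : ∀ n : ℤ, ∃ S : Matrix (Fin 2) (Fin 2) ℤ, (θ.1 - 1) * S = tbm θ n - 1 := by
  have h : ∀ n : ℕ, ∃ S : Matrix (Fin 2) (Fin 2) ℤ, (θ.1 - 1) * S = tbm θ n - 1 := by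
    intro n
    refine ⟨_, (mul_geom_sum θ.1 n).trans ?_⟩
    simp [tbm]
  intro n
  obtain ⟨n, rfl | rfl⟩ := n.eq_nat_or_neg
  · exact h n
  · obtain ⟨S, hS⟩ := h n
    refine ⟨-(S * tbm θ (-n)), ?_⟩
    rw [mul_neg, ← mul_assoc, hS, sub_mul, ← tbm_add]
    simp [tbm_zero]

noncomputable def tbS (n : ℤ) := (exists_S θ n).choose
theorem tbS_spec (n : ℤ) : (θ.1 - 1) * tbS θ n = tbm θ n - 1 := (exists_S θ n).choose_spec

theorem tb_cancel (hd : (θ.1 - 1).det ≠ 0) {A B : Matrix (Fin 2) (Fin 2) ℤ} (h : (θ.1 - 1) * A = (θ.1 - 1) * B) : A = B := by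
  have h2 := congrArg (fun X => (θ.1 - 1).adjugate * X) h
  simp only [← mul_assoc, adjugate_mul, smul_mul_assoc, one_mul] at h2
  exact smul_right_injective _ hd h2

theorem tbS_add (hd : (θ.1 - 1).det ≠ 0) (n m) : tbS θ (n + m) = tbS θ m + tbS θ n * tbm θ m := by
  apply tb_cancel θ hd
  rw [mul_add, ← mul_assoc, tbS_spec, tbS_spec, tbS_spec, tbm_add]
  noncomm_ring
theorem tbS_zero (hd : (θ.1 - 1).det ≠ 0) : tbS θ 0 = 0 := by
  apply tb_cancel θ hd
  rw [tbS_spec, tbm_zero]; simp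
theorem tbS_one (hd : (θ.1 - 1).det ≠ 0) : tbS θ 1 = 1 := by
  apply tb_cancel θ hd
  rw [tbS_spec]; simp [tbm]
end tb

section ext
variable {θ : GL (Fin 2) ℤ} {E : Type} [Group E]

theorem conj_zpow_aux (x y z : E) (hzx : Commute z x) (hzy : Commute z y) (h : x * y = z * (y * x))
    (a b : ℤ) : x ^ a * y ^ b = z ^ (a * b) * (y ^ b * x ^ a) := by
  have key : ∀ (x y z : E), Commute z y → x * y = z * (y * x) → ∀ b : ℤ,
      x * y ^ b = z ^ b * (y ^ b * x) := by
    intro x y z hz h b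
    have h1 : x * y * x⁻¹ = z * y := by rw [h]; group
    have h2 : x * y ^ b * x⁻¹ = z ^ b * y ^ b := by
      rw [← conj_zpow, h1, hz.mul_zpow]
    rw [← mul_assoc, ← h2]; group
  have h1 := key x y z hzy h b
  have h3 : y ^ b * x = (z ^ b)⁻¹ * (x * y ^ b) := by rw [h1]; group
  have h4 := key (y ^ b) x (z ^ b)⁻¹ ((hzx.zpow_left b).inv_left) h3 a
  rw [h4, mul_comm a b, _root_.zpow_mul, _root_.inv_zpow, mul_inv_cancel_left]

theorem ext_main (hdet : θ.1.det = -1) (hd : (θ.1 - 1).det ≠ 0)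
    (p : E →* TorusBundleGroup θ) (hp : Function.Surjective p)
    (ι : Multiplicative ℤ →* E) (hι : Function.Injective ι) (hc : ∀ x e, Commute (ι x) e)
    (hk : ∀ e, p e = 1 → ∃ x, ι x = e) :
    ∃ (σ : TorusBundleGroup θ → E) (w : Fin 2 → ℤ), (∀ g, p (σ g) = g) ∧
      ∀ g k, σ g * σ k =
        ι (Multiplicative.ofAdd (w ⬝ᵥ (tbS θ (tbn θ g) *ᵥ tbv θ k))) * σ (g * k) := by
  obtain ⟨x, hx⟩ := hp (tbe θ ![1, 0] 0)
  obtain ⟨y, hy⟩ := hp (tbe θ ![0, 1] 0)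
  obtain ⟨t, ht⟩ := hp (tbe θ 0 1)
  have hzp : ∀ (a : Fin 2 → ℤ) (n : ℤ), (tbe θ a 0) ^ n = tbe θ (n • a) 0 := by
    intro a n
    let F : Multiplicative (Fin 2 → ℤ) →* TorusBundleGroup θ :=
      ⟨⟨fun v => tbe θ v.toAdd 0, rfl⟩, fun u v => by simp [tbe_mul, tbm_zero]⟩
    exact (map_zpow F (Multiplicative.ofAdd a) n).symm
  -- the lift of ℤ²
  let s : (Fin 2 → ℤ) → E := fun a => x ^ (a 0) * y ^ (a 1)
  have hps : ∀ a, p (s a) = tbe θ a 0 := by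
    intro a
    simp only [s, map_mul, map_zpow, hx, hy, hzp, tbe_mul, tbm_zero]
    congr 1
    ext i; fin_cases i <;> simp
  have hdiff : ∀ e e', p e = p e' → ∃ u, e = ι u * e' := by
    intro e e' h
    obtain ⟨u, hu⟩ := hk (e * e'⁻¹) (by simp [h])
    exact ⟨u, by rw [hu]; simp⟩
  have hpt : ∀ a, p (t * s a * t⁻¹) = p (s (θ.1 *ᵥ a)) := by
    intro a
    rw [map_mul, map_inv, mul_inv_eq_iff_eq_mul, map_mul, hps, hps, ht, tbe_mul, tbe_mul]
    simp [tbm]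
  have hφ : ∀ a, ∃ u, t * s a * t⁻¹ = ι u * s (θ.1 *ᵥ a) := fun a => hdiff _ _ (hpt a)
  obtain ⟨z, hz⟩ := hdiff (x * y) (y * x) (by simp [hx, hy, tbe_mul, add_comm])
  have hcomm := conj_zpow_aux x y (ι z) (hc _ _) (hc _ _) hz
  have hsc : ∀ a b, s a * s b = ι z ^ (-(a 1 * b 0)) * s (a + b) := by
    intro a b
    simp only [s]
    have h1 := hcomm (b 0) (a 1)
    have h2 : y ^ a 1 * x ^ b 0 = ι z ^ (-(a 1 * b 0)) * (x ^ b 0 * y ^ a 1) := by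
      rw [h1, mul_comm (a 1)]; group
    calc x ^ a 0 * y ^ a 1 * (x ^ b 0 * y ^ b 1) = x ^ a 0 * (y ^ a 1 * x ^ b 0) * y ^ b 1 := by group
      _ = x ^ a 0 * ι z ^ (-(a 1 * b 0)) * (x ^ b 0 * y ^ a 1 * y ^ b 1) := by rw [h2]; group
      _ = _ := by
        rw [((hc z (x ^ a 0)).zpow_left _).eq.symm, Pi.add_apply, Pi.add_apply, _root_.zpow_add x, _root_.zpow_add y]
        simp only [mul_assoc]
  clear_value s
  have hω : ∀ a b, s a * s b = ι z ^ (a 0 * b 1 - a 1 * b 0) * (s b * s a) := by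
    intro a b
    rw [hsc, hsc, add_comm b a, ← mul_assoc, ← _root_.zpow_add]
    congr 2; ring
  have hz1 : z = 1 := by
    obtain ⟨u, hu⟩ := hφ ![1, 0]
    obtain ⟨v, hv⟩ := hφ ![0, 1]
    have h1 := hω ![1, 0] ![0, 1]
    have h2 := hω (θ.1 *ᵥ ![1, 0]) (θ.1 *ᵥ ![0, 1])
    have h3 : ((θ.1 *ᵥ ![1, 0]) 0 * (θ.1 *ᵥ ![0, 1]) 1 - (θ.1 *ᵥ ![1, 0]) 1 * (θ.1 *ᵥ ![0, 1]) 0 : ℤ) = -1 := by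
      rw [← hdet, det_fin_two]
      simp [mulVec, dotProduct, Fin.sum_univ_two]; ring
    rw [h3] at h2
    simp only [cons_val_zero, cons_val_one, mul_one, mul_zero, sub_zero, zpow_one] at h1
    set A := s ![1, 0]
    set B := s ![0, 1]
    set A' := s (θ.1 *ᵥ ![1, 0])
    set B' := s (θ.1 *ᵥ ![0, 1])
    have h4 : t * A * t⁻¹ * (t * B * t⁻¹) = ι z * ((t * B * t⁻¹) * (t * A * t⁻¹)) := by
      calc _ = t * (A * B) * t⁻¹ := by group
        _ = (t * ι z) * B * A * t⁻¹ := by rw [h1]; group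
        _ = _ := by rw [(hc z t).eq.symm]; group
    rw [hu, hv] at h4
    have h5 : ∀ P Q : E, ι u * P * (ι v * Q) = ι u * ι v * (P * Q) := by
      intro P Q
      rw [mul_assoc, ← mul_assoc P, (hc v P).eq.symm]; group
    have h6 : ∀ P Q : E, ι v * P * (ι u * Q) = ι u * ι v * (P * Q) := by
      intro P Q
      rw [mul_assoc, ← mul_assoc P, (hc u P).eq.symm, (hc u (ι v)).eq]; group
    rw [h5, h6, h2, ← mul_assoc (ι z), (hc z (ι u * ι v)).eq, mul_assoc (ι u * ι v)] at h4
    have h7 := mul_left_cancel h4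
    have h8 := mul_right_cancel h7
    rw [← map_zpow] at h8
    have h9 := hι h8
    have h10 : -(Multiplicative.toAdd z) = Multiplicative.toAdd z := by
      have := congrArg Multiplicative.toAdd h9
      simpa using this
    have : Multiplicative.toAdd z = 0 := by omega
    exact this
  have hs : ∀ a b, s a * s b = s (a + b) := by
    intro a b; rw [hsc, hz1]; simp
  choose φ hφ using hφ
  have hφadd : ∀ a b, φ (a + b) = φ a * φ b := by
    intro a b
    apply hι
    have h1 : t * s (a + b) * t⁻¹ = (t * s a * t⁻¹) * (t * s b * t⁻¹) := by rw [← hs]; group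
    rw [hφ, hφ, hφ, mulVec_add, ← hs, mul_assoc (ι (φ a)), ← mul_assoc (s _) (ι (φ b)),
      (hc (φ b) (s (θ.1 *ᵥ a))).eq.symm, mul_assoc (ι (φ b)), ← mul_assoc (ι (φ a))] at h1
    rw [map_mul]
    exact mul_right_cancel h1
  let Φ : (Fin 2 → ℤ) →+ ℤ := AddMonoidHom.mk' (fun a => (φ a).toAdd) (fun a b => by
    rw [hφadd]; rfl)
  let w : Fin 2 → ℤ := ![Φ ![1, 0], Φ ![0, 1]]
  have hw : ∀ a, φ a = Multiplicative.ofAdd (w ⬝ᵥ a) := by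
    intro a
    have : a = a 0 • ![1, 0] + a 1 • ![0, 1] := by
      ext i; fin_cases i <;> simp
    have h2 : Φ a = w ⬝ᵥ a := by
      conv_lhs => rw [this, map_add, map_zsmul, map_zsmul]
      simp [w, dotProduct, Fin.sum_univ_two, mul_comm]
    rw [← h2]; rfl
  have hstep : ∀ n : ℤ, (∀ b, t ^ n * s b * (t ^ n)⁻¹ =
      ι (Multiplicative.ofAdd (w ⬝ᵥ (tbS θ n *ᵥ b))) * s (tbm θ n *ᵥ b)) ↔
      (∀ b, t ^ (n + 1) * s b * (t ^ (n + 1))⁻¹ =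
      ι (Multiplicative.ofAdd (w ⬝ᵥ (tbS θ (n + 1) *ᵥ b))) * s (tbm θ (n + 1) *ᵥ b)) := by
    intro n
    have e1 : ∀ b, t ^ (n + 1) * s b * (t ^ (n + 1))⁻¹
        = ι (φ b) * (t ^ n * s (θ.1 *ᵥ b) * (t ^ n)⁻¹) := by
      intro b
      calc _ = t ^ n * (t * s b * t⁻¹) * (t ^ n)⁻¹ := by group
        _ = (t ^ n * ι (φ b)) * s (θ.1 *ᵥ b) * (t ^ n)⁻¹ := by rw [hφ]; group
        _ = _ := by rw [(hc _ _).eq.symm]; group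
    have e2 : ∀ b, ι (Multiplicative.ofAdd (w ⬝ᵥ (tbS θ (n + 1) *ᵥ b))) * s (tbm θ (n + 1) *ᵥ b)
        = ι (φ b) * (ι (Multiplicative.ofAdd (w ⬝ᵥ (tbS θ n *ᵥ (θ.1 *ᵥ b)))) *
          s (tbm θ n *ᵥ (θ.1 *ᵥ b))) := by
      intro b
      have o : tbm θ 1 = θ.1 := by simp [tbm]
      rw [tbS_add θ hd, tbS_one θ hd, tbm_add, o, hw, ← mul_assoc, ← map_mul, ← ofAdd_add,
        ← dotProduct_add, mulVec_mulVec, mulVec_mulVec, add_mulVec, one_mulVec]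
    constructor
    · intro h b
      rw [e1, e2, h]
    · intro h b
      have hb : b = θ.1 *ᵥ (θ⁻¹.1 *ᵥ b) := by
        rw [mulVec_mulVec, ← Units.val_mul]; simp
      have := h (θ⁻¹.1 *ᵥ b)
      rw [e1, e2] at this
      rw [hb]
      exact mul_left_cancel this
  have hall : ∀ n : ℤ, (∀ b, t ^ n * s b * (t ^ n)⁻¹ =
      ι (Multiplicative.ofAdd (w ⬝ᵥ (tbS θ n *ᵥ b))) * s (tbm θ n *ᵥ b)) := by
    intro n
    induction n using Int.induction_on with
    | zero => intro b; simp [tbS_zero θ hd]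
    | succ i ih => exact (hstep _).1 ih
    | pred i ih => exact (hstep _).2 (by simpa using ih)
  have hpt2 : ∀ n : ℤ, p (t ^ n) = tbe θ 0 n := by
    intro n
    let F : Multiplicative ℤ →* TorusBundleGroup θ :=
      ⟨⟨fun v => tbe θ 0 v.toAdd, rfl⟩, fun u v => by simp [tbe_mul]⟩
    rw [map_zpow, ht]
    have := (map_zpow F (Multiplicative.ofAdd 1) n).symm
    refine Eq.trans this ?_
    rw [← ofAdd_zsmul, smul_eq_mul, mul_one]
    rfl
  refine ⟨fun g => s (tbv θ g) * t ^ (tbn θ g), w, ?_, ?_⟩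
  · intro g
    rw [map_mul, hps, hpt2, tbe_mul, tbm_zero]
    conv_rhs => rw [tbe_surj θ g]
    simp
  · intro g k
    rw [tbe_surj θ g, tbe_surj θ k, tbe_mul]
    simp only [tbv_tbe, tbn_tbe]
    generalize tbv θ g = a; generalize tbn θ g = n; generalize tbv θ k = b; generalize tbn θ k = m
    calc _ = s a * (t ^ n * s b * (t ^ n)⁻¹) * (t ^ n * t ^ m) := by group
      _ = (s a * ι (Multiplicative.ofAdd (w ⬝ᵥ (tbS θ n *ᵥ b)))) * s (tbm θ n *ᵥ b) * t ^ (n + m) := by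
        rw [hall, _root_.zpow_add]; simp only [mul_assoc]
      _ = _ := by rw [(hc _ _).eq.symm, ← hs]; simp only [mul_assoc]
end ext
/-- Smith form predicate for two-by-two integer matrices -/
def HasSmith2 (M : Matrix (Fin 2) (Fin 2) ℤ) : Prop :=
  ∃ U V : Matrix (Fin 2) (Fin 2) ℤ, ∃ c d : ℤ, IsUnit U.det ∧ IsUnit V.det ∧ c ∣ d ∧
    U * M * V = !![c, 0; 0, d]

theorem HasSmith2.of_mul {M : Matrix (Fin 2) (Fin 2) ℤ} (U V : Matrix (Fin 2) (Fin 2) ℤ)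
    (hU : IsUnit U.det) (hV : IsUnit V.det) (h : HasSmith2 (U * M * V)) : HasSmith2 M := by
  obtain ⟨U', V', c, d, h1, h2, h3, h4⟩ := h
  refine ⟨U' * U, V * V', c, d, ?_, ?_, h3, ?_⟩
  · rw [det_mul]; exact h1.mul hU
  · rw [det_mul]; exact hV.mul h2
  · rw [← h4]; simp only [Matrix.mul_assoc]

theorem hasSmith2_aux (n : ℕ) : ∀ a b c d : ℤ, a ≠ 0 → a.natAbs = n →
    HasSmith2 !![a, b; c, d] := by
  induction n using Nat.strong_induction_on with
  | _ n ih =>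
    intro a b c d ha hn
    have lt : ∀ x : ℤ, (x % a).natAbs < n := by
      intro x
      have h1 := Int.emod_nonneg x ha
      have h2 := Int.emod_lt_abs x ha
      rw [Int.abs_eq_natAbs] at h2
      omega
    have ne : ∀ x : ℤ, ¬ a ∣ x → x % a ≠ 0 := fun x hx h => hx (Int.dvd_of_emod_eq_zero h)
    have key : ∀ x : ℤ, x - a * (x / a) = x % a := fun x => by
      have := Int.mul_ediv_add_emod x a; linarith
    by_cases hb : a ∣ b
    · by_cases hc : a ∣ c
      · obtain ⟨q, rfl⟩ := hb
        obtain ⟨r, rfl⟩ := hc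
        by_cases hs : a ∣ d - a * r * q
        · refine ⟨!![1, 0; -r, 1], !![1, -q; 0, 1], a, d - a * r * q, by simp, by simp, hs, ?_⟩
          ext i j; fin_cases i <;> fin_cases j <;> simp [Matrix.mul_apply, Fin.sum_univ_two] <;> ring
        · refine HasSmith2.of_mul (!![1, 1; 0, 1] * !![1, 0; -r, 1])
            (!![1, -q; 0, 1] * !![-((d - a * r * q) / a), 1; 1, 0]) (by simp) (by simp) ?_
          have := ih _ (lt (d - a * r * q)) ((d - a * r * q) % a) a (d - a * r * q) 0 (ne _ hs) rfl
          convert this using 1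
          have k := key (d - a * r * q)
          generalize (d - a * r * q) / a = u at *
          generalize (d - a * r * q) % a = v at *
          subst k
          ext i j; fin_cases i <;> fin_cases j <;> simp [Matrix.mul_apply, Fin.sum_univ_two] <;> ring
      · refine HasSmith2.of_mul (!![-(c / a), 1; 1, 0]) 1 (by simp) (by simp) ?_
        have := ih _ (lt c) (c % a) (d - b * (c / a)) a b (ne _ hc) rfl
        convert this using 1
        rw [← key c]
        ext i j; fin_cases i <;> fin_cases j <;> simp [Matrix.mul_apply, Fin.sum_univ_two] <;> ring
    · refine HasSmith2.of_mul 1 (!![-(b / a), 1; 1, 0]) (by simp) (by simp) ?_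
      have := ih _ (lt b) (b % a) a (d - c * (b / a)) c (ne _ hb) rfl
      convert this using 1
      rw [← key b]
      ext i j; fin_cases i <;> fin_cases j <;> simp [Matrix.mul_apply, Fin.sum_univ_two] <;> ring

theorem hasSmith2 (M : Matrix (Fin 2) (Fin 2) ℤ) (hM : M.det ≠ 0) : HasSmith2 M := by
  by_cases h : M 0 0 = 0
  · have h10 : M 1 0 ≠ 0 := by
      intro h'; apply hM; rw [det_fin_two, h, h']; simp
    refine HasSmith2.of_mul !![0, 1; 1, 0] 1 (by simp) (by simp) ?_
    have := hasSmith2_aux _ (M 1 0) (M 1 1) (M 0 0) (M 0 1) h10 rfl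
    convert this using 1
    ext i j; fin_cases i <;> fin_cases j <;> simp [vecMul, dotProduct, Fin.sum_univ_two]
  · have := hasSmith2_aux _ (M 0 0) (M 0 1) (M 1 0) (M 1 1) h rfl
    rwa [← eta_fin_two M] at this

/-- The presentation of the cokernel of a nonsingular two-by-two integer matrix. -/
theorem exists_coker (M : Matrix (Fin 2) (Fin 2) ℤ) (hM : M.det ≠ 0) :
    ∃ c₁ c₂ : ℕ, 0 < c₁ ∧ 0 < c₂ ∧ c₁ ∣ c₂ ∧ c₁ * c₂ = M.det.natAbs ∧
      ∃ π : (Fin 2 → ℤ) →+ (ZMod c₁ × ZMod c₂), Function.Surjective π ∧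
        ∀ w, π w = 0 ↔ ∃ u, w = M *ᵥ u := by
  obtain ⟨U, V, c, d, hU, hV, hcd, h⟩ := hasSmith2 M hM
  have hdet : c.natAbs * d.natAbs = M.det.natAbs := by
    have := congrArg (fun X => X.det.natAbs) h
    simp only [det_mul, Int.natAbs_mul, Int.isUnit_iff_natAbs_eq.1 hU,
      Int.isUnit_iff_natAbs_eq.1 hV] at this
    simp [Int.natAbs_mul] at this
    exact this.symm
  have hpos : M.det.natAbs ≠ 0 := by simpa using hM
  have hc : c.natAbs ≠ 0 := by rintro h0; rw [h0] at hdet; simp at hdet; omega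
  have hd : d.natAbs ≠ 0 := by rintro h0; rw [h0] at hdet; simp at hdet; omega
  refine ⟨c.natAbs, d.natAbs, by omega, by omega, Int.natAbs_dvd_natAbs.2 hcd, hdet,
    ⟨⟨fun w => (((U *ᵥ w) 0 : ℤ), ((U *ᵥ w) 1 : ℤ)), by simp⟩, fun x y => by
      simp [mulVec_add]⟩, ?_, ?_⟩
  · rintro ⟨x, y⟩
    obtain ⟨x, rfl⟩ := ZMod.intCast_surjective x
    obtain ⟨y, rfl⟩ := ZMod.intCast_surjective y
    refine ⟨U⁻¹ *ᵥ ![x, y], ?_⟩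
    simp only [AddMonoidHom.coe_mk, ZeroHom.coe_mk]
    rw [mulVec_mulVec, mul_nonsing_inv _ hU, one_mulVec]
    simp
  · intro w
    simp only [AddMonoidHom.coe_mk, ZeroHom.coe_mk, Prod.mk_eq_zero, 
      ZMod.intCast_zmod_eq_zero_iff_dvd, Int.natAbs_dvd]
    constructor
    · rintro ⟨⟨x, hx⟩, ⟨y, hy⟩⟩
      refine ⟨V *ᵥ ![x, y], ?_⟩
      have : U *ᵥ w = U *ᵥ (M *ᵥ (V *ᵥ ![x, y])) := by
        rw [mulVec_mulVec, mulVec_mulVec, h]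
        ext i; fin_cases i
        · simpa [mulVec, dotProduct, Fin.sum_univ_two] using hx
        · simpa [mulVec, dotProduct, Fin.sum_univ_two] using hy
      have h2 := congrArg (fun v => U⁻¹ *ᵥ v) this
      rwa [mulVec_mulVec w, nonsing_inv_mul _ hU, one_mulVec, mulVec_mulVec (M *ᵥ _) U⁻¹ U,
        nonsing_inv_mul _ hU, one_mulVec] at h2
    · rintro ⟨u, rfl⟩
      have : U *ᵥ (M *ᵥ u) = !![c, 0; 0, d] *ᵥ (V⁻¹ *ᵥ u) := by
        rw [← h]; rw [mulVec_mulVec, mulVec_mulVec, mul_nonsing_inv_cancel_right _ _ hV]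
      rw [this]
      constructor <;> simp [mulVec, dotProduct, Fin.sum_univ_two]

section cext
variable {G : Type} [Group G]

/-- The central extension of `G` by `ℤ` given by a 2-cocycle. -/
structure CExt (f : G × G → ℤ) (hf : ∀ g h j : G, f (g * h, j) + f (g, h) = f (h, j) + f (g, h * j)) where
  x : ℤ
  g : G

variable {f : G × G → ℤ} {hf : ∀ g h j : G, f (g * h, j) + f (g, h) = f (h, j) + f (g, h * j)}

theorem cext_fst (hf : ∀ g h j : G, f (g * h, j) + f (g, h) = f (h, j) + f (g, h * j)) (g : G) :
    f (1, g) = f (1, 1) := by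
  have := hf 1 1 g
  simp only [one_mul] at this
  linarith

theorem cext_snd (hf : ∀ g h j : G, f (g * h, j) + f (g, h) = f (h, j) + f (g, h * j)) (g : G) :
    f (g, 1) = f (1, 1) := by
  have := hf g 1 1
  simp only [mul_one] at this
  linarith

theorem CExt.ext' {a b : CExt f hf} (h1 : a.x = b.x) (h2 : a.g = b.g) : a = b := by
  cases a; cases b; simp_all

instance : Mul (CExt f hf) := ⟨fun a b => ⟨a.x + b.x + f (a.g, b.g), a.g * b.g⟩⟩
instance : One (CExt f hf) := ⟨⟨-f (1, 1), 1⟩⟩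
instance : Inv (CExt f hf) := ⟨fun a => ⟨-a.x - f (a.g⁻¹, a.g) - f (1, 1), a.g⁻¹⟩⟩
theorem CExt.mul_x (a b : CExt f hf) : (a * b).x = a.x + b.x + f (a.g, b.g) := rfl
theorem CExt.mul_g (a b : CExt f hf) : (a * b).g = a.g * b.g := rfl
theorem CExt.one_x : (1 : CExt f hf).x = - f (1, 1) := rfl
theorem CExt.one_g : (1 : CExt f hf).g = 1 := rfl
theorem CExt.inv_x (a : CExt f hf) : (a⁻¹).x = -a.x - f (a.g⁻¹, a.g) - f (1, 1) := rfl
theorem CExt.inv_g (a : CExt f hf) : (a⁻¹).g = a.g⁻¹ := rfl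

instance : Group (CExt f hf) := Group.ofLeftAxioms
  (fun a b c => CExt.ext' (by
    have := hf a.g b.g c.g
    simp only [CExt.mul_x, CExt.mul_g]; linarith) (mul_assoc _ _ _))
  (fun a => CExt.ext' (by
    simp only [CExt.mul_x, CExt.one_x, CExt.one_g, cext_fst hf]; ring) (one_mul _))
  (fun a => CExt.ext' (by
    simp only [CExt.mul_x, CExt.inv_x, CExt.inv_g, CExt.one_x]; ring) (inv_mul_cancel _))

end cext

theorem cocycle_main {θ : GL (Fin 2) ℤ} (hdet : θ.1.det = -1) (hd : (θ.1 - 1).det ≠ 0)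
    (f : TorusBundleGroup θ × TorusBundleGroup θ → ℤ)
    (hf : ∀ g h j, f (g * h, j) + f (g, h) = f (h, j) + f (g, h * j)) :
    ∃ (w : Fin 2 → ℤ) (x : TorusBundleGroup θ → ℤ), ∀ g k,
      (w ⬝ᵥ (tbS θ (tbn θ g) *ᵥ tbv θ k)) - f (g, k) = x k - x (g * k) + x g := by
  let p : CExt f hf →* TorusBundleGroup θ := ⟨⟨fun a => a.g, rfl⟩, fun _ _ => rfl⟩
  let ι : Multiplicative ℤ →* CExt f hf := ⟨⟨fun n => ⟨n.toAdd - f (1, 1), 1⟩,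
    CExt.ext' (by simp [CExt.one_x]) rfl⟩, fun a b => CExt.ext' (by
      simp only [CExt.mul_x, toAdd_mul]; ring) (by simp [CExt.mul_g])⟩
  have ιx : ∀ n, (ι n).x = n.toAdd - f (1, 1) := fun _ => rfl
  have ιg : ∀ n, (ι n).g = 1 := fun _ => rfl
  obtain ⟨σ, w, h1, h2⟩ := ext_main hdet hd p (fun g => ⟨⟨0, g⟩, rfl⟩) ι
    (fun a b hab => by
      have := congrArg CExt.x hab
      rw [ιx, ιx] at this
      exact Multiplicative.toAdd.injective (by linarith))
    (fun n e => CExt.ext' (by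
      simp only [CExt.mul_x, ιx, ιg, cext_fst hf, cext_snd hf]; ring) (by
      simp [CExt.mul_g, ιg]))
    (fun e he => ⟨Multiplicative.ofAdd (e.x + f (1, 1)), CExt.ext' (by
      rw [ιx, toAdd_ofAdd]; ring) he.symm⟩)
  refine ⟨w, fun g => (σ g).x, fun g k => ?_⟩
  have h3 := congrArg CExt.x (h2 g k)
  have h1' : ∀ g, (σ g).g = g := h1
  simp only [CExt.mul_x, ιx, ιg, cext_fst hf, h1', toAdd_ofAdd] at h3
  linarith

theorem coboundary_iff {θ : GL (Fin 2) ℤ} (hd : (θ.1 - 1).det ≠ 0) (w : Fin 2 → ℤ) :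
    (∃ x : TorusBundleGroup θ → ℤ, ∀ g k,
      (w ⬝ᵥ (tbS θ (tbn θ g) *ᵥ tbv θ k)) = x k - x (g * k) + x g) ↔
      ∃ u, w = (θ.1 - 1)ᵀ *ᵥ u := by
  constructor
  · rintro ⟨x, hx⟩
    have hx' : ∀ a n b m, (w ⬝ᵥ (tbS θ n *ᵥ b)) =
        x (tbe θ b m) - x (tbe θ (a + tbm θ n *ᵥ b) (n + m)) + x (tbe θ a n) := by
      intro a n b m
      have := hx (tbe θ a n) (tbe θ b m)
      rwa [tbe_mul] at this
    let X : (Fin 2 → ℤ) →+ ℤ := AddMonoidHom.mk' (fun a => x (tbe θ a 0)) (fun a b => by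
      have := hx' a 0 b 0
      simp only [tbS_zero θ hd, tbm_zero, one_mulVec, zero_mulVec, dotProduct_zero, add_zero] at this
      linarith)
    have hX : ∀ a, X a = x (tbe θ a 0) := fun _ => rfl
    have h1 : ∀ b, w ⬝ᵥ b = X b - X (θ.1 *ᵥ b) := by
      intro b
      have e1 := hx' 0 1 b 0
      have e2 := hx' (θ.1 *ᵥ b) 0 0 1
      have o : tbm θ 1 = θ.1 := by simp [tbm]
      simp only [tbS_zero θ hd, tbS_one θ hd, tbm_zero, one_mulVec, zero_mulVec, dotProduct_zero,
        add_zero, zero_add, o] at e1 e2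
      rw [hX, hX]
      linarith
    let u : Fin 2 → ℤ := ![X ![1, 0], X ![0, 1]]
    have hu : ∀ a, X a = u ⬝ᵥ a := by
      intro a
      have : a = a 0 • ![1, 0] + a 1 • ![0, 1] := by
        ext i; fin_cases i <;> simp
      conv_lhs => rw [this, map_add, map_zsmul, map_zsmul]
      simp [u, dotProduct, Fin.sum_univ_two, mul_comm]
    refine ⟨-u, ?_⟩
    apply dotProduct_eq
    intro b
    rw [h1, hu, hu, mulVec_transpose, ← dotProduct_mulVec, sub_mulVec, one_mulVec]
    simp only [neg_dotProduct, dotProduct_sub]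
    ring
  · rintro ⟨u, rfl⟩
    refine ⟨fun g => - (u ⬝ᵥ tbv θ g), fun g k => ?_⟩
    rw [tbe_surj θ g, tbe_surj θ k, tbe_mul]
    simp only [tbv_tbe, tbn_tbe]
    rw [mulVec_transpose, ← dotProduct_mulVec, mulVec_mulVec, tbS_spec, sub_mulVec, one_mulVec]
    simp only [dotProduct_sub, dotProduct_add]
    ring

theorem H2_param {θ : GL (Fin 2) ℤ} (hdet : θ.1.det = -1) (hd : (θ.1 - 1).det ≠ 0) :
    ∃ Ψ : (Fin 2 → ℤ) →+ groupCohomology (Rep.trivial ℤ (TorusBundleGroup θ) ℤ) 2,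
      Function.Surjective Ψ ∧ ∀ w, Ψ w = 0 ↔ ∃ u, w = (θ.1 - 1)ᵀ *ᵥ u := by
  let A := Rep.trivial ℤ (TorusBundleGroup θ) ℤ
  have hcoc : ∀ f : TorusBundleGroup θ × TorusBundleGroup θ → ℤ,
      f ∈ groupCohomology.cocycles₂ A ↔
        ∀ g h j, f (g * h, j) + f (g, h) = f (h, j) + f (g, h * j) := fun f =>
    groupCohomology.mem_cocycles₂_iff (A := A) f
  have hcob : ∀ f : TorusBundleGroup θ × TorusBundleGroup θ → ℤ,
      f ∈ groupCohomology.coboundaries₂ A ↔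
        ∃ x : TorusBundleGroup θ → ℤ, ∀ g k, f (g, k) = x k - x (g * k) + x g := by
    intro f
    constructor
    · rintro ⟨x, hx⟩
      exact ⟨x, fun g k => (congrFun hx (g, k)).symm⟩
    · rintro ⟨x, hx⟩
      exact ⟨x, funext fun ⟨g, k⟩ => (hx g k).symm⟩
  let c : (Fin 2 → ℤ) → TorusBundleGroup θ × TorusBundleGroup θ → ℤ :=
    fun w q => w ⬝ᵥ (tbS θ (tbn θ q.1) *ᵥ tbv θ q.2)
  have hc : ∀ w, c w ∈ groupCohomology.cocycles₂ A := by
    intro w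
    rw [hcoc]
    intro g h j
    simp only [c]
    rw [tbe_surj θ g, tbe_surj θ h, tbe_surj θ j, tbe_mul, tbe_mul]
    simp only [tbv_tbe, tbn_tbe]
    rw [tbS_add θ hd, ← dotProduct_add, ← dotProduct_add, add_mulVec, mulVec_add, mulVec_mulVec]
    congr 1; abel
  let F : (Fin 2 → ℤ) →+ groupCohomology.cocycles₂ A :=
    AddMonoidHom.mk' (fun w => ⟨c w, hc w⟩) (fun a b => Subtype.ext (funext fun q =>
      add_dotProduct a b (tbS θ (tbn θ q.1) *ᵥ tbv θ q.2)))
  refine ⟨(groupCohomology.H2π A).hom.toAddMonoidHom.comp F, ?_, ?_⟩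
  · intro y
    induction y using groupCohomology.H2_induction_on with
    | h f =>
      obtain ⟨w, x, hx⟩ := cocycle_main hdet hd f.1 ((hcoc f.1).1 f.2)
      refine ⟨w, ?_⟩
      refine (groupCohomology.H2π_eq_iff (F w) f).2 ?_
      exact (hcob _).2 ⟨x, hx⟩
  · intro w
    refine (groupCohomology.H2π_eq_zero_iff (F w)).trans ((hcob _).trans ?_)
    exact coboundary_iff hd w

theorem equiv_of_surj {N P Q : Type*} [AddCommGroup N] [AddCommGroup P] [AddCommGroup Q]
    (f : N →+ P) (g : N →+ Q) (hf : Function.Surjective f) (hg : Function.Surjective g)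
    (h : ∀ w, f w = 0 ↔ g w = 0) : Nonempty (P ≃+ Q) := by
  have hk : f.ker = g.ker := by ext w; exact h w
  exact ⟨(QuotientAddGroup.quotientKerEquivOfSurjective f hf).symm.trans
    ((QuotientAddGroup.quotientAddEquivOfEq hk).trans
      (QuotientAddGroup.quotientKerEquivOfSurjective g hg))⟩

/-- If `θ - I` has rank `2` and `det θ = -1`, then `H²(G, ℤ) ≅ ℤ/c₁ ⊕ ℤ/c₂` for
positive integers `c₁ ∣ c₂` with `c₁·c₂ = |det (θ - I)|`. -/
theorem torusBundle_H2_rank2_detNegOne (θ : GL (Fin 2) ℤ)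
    (hr : ((θ : Matrix (Fin 2) (Fin 2) ℤ) - 1).rank = 2)
    (hdet : (θ : Matrix (Fin 2) (Fin 2) ℤ).det = -1) :
    ∃ c₁ c₂ : ℕ, 0 < c₁ ∧ 0 < c₂ ∧ c₁ ∣ c₂ ∧
      c₁ * c₂ = ((θ : Matrix (Fin 2) (Fin 2) ℤ) - 1).det.natAbs ∧
      Nonempty ((groupCohomology (Rep.trivial ℤ (TorusBundleGroup θ) ℤ) 2) ≃+ (ZMod c₁ × ZMod c₂)) := by

  have hd : (θ.1 - 1).det ≠ 0 := by
    intro h0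
    obtain ⟨v, hv, hv0⟩ := Matrix.exists_mulVec_eq_zero_iff.2 h0
    have h1 := Submodule.finrank_quotient_add_finrank (LinearMap.ker (θ.1 - 1).mulVecLin)
    rw [(θ.1 - 1).mulVecLin.quotKerEquivRange.finrank_eq] at h1
    rw [Matrix.rank] at hr
    rw [hr, Module.finrank_fin_fun] at h1
    have h2 : Module.finrank ℤ (LinearMap.ker (θ.1 - 1).mulVecLin) = 0 := by omega
    have h3 := Submodule.finrank_eq_zero.1 h2
    have h4 : v ∈ LinearMap.ker (θ.1 - 1).mulVecLin := hv0
    rw [h3] at h4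
    exact hv (by simpa using h4)
  obtain ⟨Ψ, h1, h2⟩ := H2_param hdet hd
  obtain ⟨c₁, c₂, p1, p2, p3, p4, π, p5, p6⟩ :=
    exists_coker (θ.1 - 1)ᵀ (by rwa [Matrix.det_transpose])
  refine ⟨c₁, c₂, p1, p2, p3, ?_, ?_⟩
  · rw [p4, Matrix.det_transpose]
  · exact equiv_of_surj Ψ π h1 p5 (fun w => (h2 w).trans (p6 w).symm)
end

section
/- If det θ = 1, then H³(G, ℤ) ≅ ℤ. -/
open CategoryTheory groupCohomology

noncomputable section
namespace TB

lemma rep_exact {k G : Type} [CommRing k] [Group G] (X : ShortComplex (Rep.{0} k G))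
    (h : ∀ x : X.X₂, X.g.hom x = 0 → ∃ y : X.X₁, X.f.hom y = x) : X.Exact := by
  rw [← ShortComplex.exact_map_iff_of_faithful _ (forget₂ (Rep.{0} k G) (ModuleCat k))]
  rw [ShortComplex.moduleCat_exact_iff]
  exact h

variable {G : Type} [Group G] 

abbrev Mo (S : Subgroup G) : Rep ℤ G := Rep.coind S.subtype (Rep.trivial ℤ S ℤ)

lemma Mo_inv {S : Subgroup G} (F : Mo S) (s : G) (hs : s ∈ S) (x : G) : F.1 (s * x) = F.1 x :=
  F.2 ⟨s, hs⟩ x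

def mkMo (S : Subgroup G) (F : G → ℤ) (h : ∀ s ∈ S, ∀ x, F (s * x) = F x) : Mo S :=
  ⟨F, fun s x => h s.1 s.2 x⟩

def iota (S : Subgroup G) : Rep.trivial ℤ G ℤ ⟶ Mo S := Rep.ofHom
  { toFun := fun c => mkMo S (fun _ => c) (fun _ _ _ => rfl)
    map_add' := fun _ _ => rfl
    map_smul' := fun _ _ => rfl
    isIntertwining' := fun g => by ext; rfl }

def DD (S : Subgroup G) [S.Normal] (t : G) : Mo S ⟶ Mo S := Rep.ofHom
  { toFun := fun F => mkMo S (fun x => F.1 (t * x) - F.1 x) (fun s hs x => by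
      rw [Mo_inv F s hs]
      have : t * (s * x) = (t * s * t⁻¹) * (t * x) := by group
      rw [this, Mo_inv F _ (Subgroup.Normal.conj_mem inferInstance s hs t)])
    map_add' := fun F F' => by
      apply Subtype.ext; funext x
      change (F.1 _ + F'.1 _) - (F.1 _ + F'.1 _) = (F.1 _ - F.1 _) + (F'.1 _ - F'.1 _)
      ring
    map_smul' := fun c F => by
      apply Subtype.ext; funext x
      change c * F.1 _ - c * F.1 _ = c * (F.1 _ - F.1 _)
      ring
    isIntertwining' := fun g => by
      ext F x
      change F.1 (t * x * g) - F.1 (x * g) = F.1 (t * (x * g)) - F.1 (x * g)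
      rw [mul_assoc] }

lemma DD_apply (S : Subgroup G) [S.Normal] (t : G) (F : Mo S) (x : G) :
    ((DD S t).hom F).1 x = F.1 (t * x) - F.1 x := rfl

lemma exists_antideriv (f : ℤ → ℤ) : ∃ e : ℤ → ℤ, ∀ k, e (k + 1) - e k = f k := by
  refine ⟨fun n => if 0 ≤ n then ∑ i ∈ Finset.range n.toNat, f i
    else - ∑ i ∈ Finset.range (-n).toNat, f (-i - 1), fun k => ?_⟩
  rcases lt_trichotomy k (-1) with h | h | h
  · obtain ⟨m, rfl⟩ : ∃ m : ℕ, k = -(m:ℤ) - 2 := ⟨(-k-2).toNat, by omega⟩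
    have h1 : ¬ (0 ≤ -(m:ℤ) - 2 + 1) := by omega
    have h2 : ¬ (0 ≤ -(m:ℤ) - 2) := by omega
    have h3 : (-(-(m:ℤ) - 2 + 1)).toNat = m + 1 := by omega
    have h4 : (-(-(m:ℤ) - 2)).toNat = m + 2 := by omega
    simp only [h1, h2, if_false, h3, h4]
    rw [Finset.sum_range_succ _ (m+1)]
    have : -((m+1 : ℕ):ℤ) - 1 = -(m:ℤ) - 2 := by push_cast; ring
    rw [this]; ring
  · subst h; simp
  · obtain ⟨m, rfl⟩ : ∃ m : ℕ, k = m := ⟨k.toNat, by omega⟩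
    have h1 : (0 ≤ (m:ℤ) + 1) := by omega
    have h3 : ((m:ℤ) + 1).toNat = m + 1 := by omega
    simp [h1, h3, Finset.sum_range_succ]

variable (π : G →* Multiplicative ℤ) (t : G) (ht : π t = Multiplicative.ofAdd 1)

def SC : ShortComplex (Rep ℤ G) := ShortComplex.mk (iota π.ker) (DD π.ker t) (by
  ext c
  change (1:ℤ) - 1 = (0:ℤ)
  ring)

include ht in
lemma decomp (x : G) : x * t ^ (-(π x).toAdd) ∈ π.ker := by
  rw [MonoidHom.mem_ker, map_mul, map_zpow, ht]
  apply Multiplicative.toAdd.injective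
  simp

include ht in
lemma SC_exact : (SC π t).ShortExact := by
  have key : ∀ (F : Mo π.ker) x, F.1 x = F.1 (t ^ (π x).toAdd) := fun F x => by
    rw [← Mo_inv F _ (decomp π t ht x) (t ^ (π x).toAdd)]
    group
  refine { exact := ?_, mono_f := ?_, epi_g := ?_ }
  · apply rep_exact
    intro F hF
    have h0 : ∀ x, F.1 (t * x) = F.1 x := fun x => by
      have := congrFun (congrArg Subtype.val hF) x
      exact sub_eq_zero.1 this
    refine ⟨F.1 1, ?_⟩
    apply Subtype.ext; funext x
    change F.1 1 = F.1 x
    rw [key F x]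
    generalize (π x).toAdd = k
    induction k using Int.induction_on with
    | zero => simp
    | succ n ih => rw [add_comm, zpow_add, zpow_one, h0]; exact ih
    | pred n ih => rw [← h0 (t ^ (-(n:ℤ) - 1)), ← zpow_one_add]; simpa using ih
  · rw [Rep.mono_iff_injective]
    intro a b h
    exact congrFun (congrArg Subtype.val h) 1
  · rw [Rep.epi_iff_surjective]
    intro F
    obtain ⟨e, he⟩ := exists_antideriv (fun k => F.1 (t ^ k))
    refine ⟨mkMo _ (fun x => e (π x).toAdd) (fun s hs x => ?_), ?_⟩
    · rw [map_mul, MonoidHom.mem_ker.1 hs, one_mul]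
    · apply Subtype.ext; funext x
      change e (π (t * x)).toAdd - e (π x).toAdd = F.1 x
      rw [key F x, map_mul, ht, toAdd_mul, toAdd_ofAdd, add_comm, he]

abbrev HZ (G : Type) [Group G] (n : ℕ) := groupCohomology (Rep.trivial ℤ G ℤ) n

include ht in
lemma vanish (n : ℕ) (h1 : Limits.IsZero (HZ π.ker n)) (h2 : Limits.IsZero (HZ π.ker (n+1))) :
    Limits.IsZero (HZ G (n+1)) := by
  have h1' : Limits.IsZero (groupCohomology (Mo π.ker) n) := h1.of_iso (coindIso _ _)
  have h2' : Limits.IsZero (groupCohomology (Mo π.ker) (n+1)) := h2.of_iso (coindIso _ _)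
  have := isIso_δ_of_isZero (SC_exact π t ht) n h1' h2'
  exact h1'.of_iso (asIso (δ (SC_exact π t ht) n (n+1) rfl)).symm

include ht in
lemma step (n : ℕ) (h2 : Limits.IsZero (HZ π.ker (n+1)))
    (hD : groupCohomology.map (A := Mo π.ker) (B := Mo π.ker) (MonoidHom.id G) (DD π.ker t) n = 0) :
    Nonempty (HZ G (n+1) ≅ HZ π.ker n) := by
  have h2' : Limits.IsZero (groupCohomology (Mo π.ker) (n+1)) := h2.of_iso (coindIso _ _)
  have := epi_δ_of_isZero (SC_exact π t ht) n h2'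
  have : Mono (δ (SC_exact π t ht) n (n+1) rfl) :=
    (mapShortComplex₃_exact (SC_exact π t ht) (i := n) rfl).mono_g hD
  have : IsIso (δ (SC_exact π t ht) n (n+1) rfl) := isIso_of_mono_of_epi _
  exact ⟨(asIso (δ (SC_exact π t ht) n (n+1) rfl)).symm ≪≫ coindIso _ _⟩

def HZiso {G H : Type} [Group G] [Group H] (e : G ≃* H) (n : ℕ) : HZ H n ≅ HZ G n :=
  groupCohomology.mapIso (A := Rep.trivial ℤ G ℤ) (B := Rep.trivial ℤ H ℤ) e.symm (LinearEquiv.refl ℤ ℤ) (fun _ => rfl) n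


lemma kerTriv : Subsingleton (MonoidHom.id (Multiplicative ℤ)).ker := by
  refine ⟨fun a b => Subtype.ext ?_⟩
  have ha := MonoidHom.mem_ker.1 a.2
  have hb := MonoidHom.mem_ker.1 b.2
  exact ha.trans hb.symm

lemma vanish_Z (n : ℕ) : Limits.IsZero (HZ (Multiplicative ℤ) (n + 2)) := by
  have := kerTriv
  exact vanish (MonoidHom.id (Multiplicative ℤ)) (Multiplicative.ofAdd 1) rfl (n+1)
    (isZero_groupCohomology_succ_of_subsingleton _ _)
    (isZero_groupCohomology_succ_of_subsingleton _ _)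

abbrev Z2 := Multiplicative (Fin 2 → ℤ)

def pr : Z2 →* Multiplicative ℤ := AddMonoidHom.toMultiplicative (Pi.evalAddMonoidHom _ 1)

def kerEquiv : pr.ker ≃* Multiplicative ℤ where
  toFun x := Multiplicative.ofAdd (x.1.toAdd 0)
  invFun n := ⟨Multiplicative.ofAdd ![n.toAdd, 0], by rw [MonoidHom.mem_ker]; rfl⟩
  left_inv x := by
    have hx : x.1.toAdd 1 = 0 := MonoidHom.mem_ker.1 x.2
    apply Subtype.ext
    apply Multiplicative.toAdd.injective
    funext i
    fin_cases i
    · rfl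
    · exact hx.symm
  right_inv n := rfl
  map_mul' x y := rfl

lemma vanish_Z2 (n : ℕ) : Limits.IsZero (HZ Z2 (n + 3)) :=
  vanish pr (Multiplicative.ofAdd ![0, 1]) rfl (n+2)
    ((vanish_Z n).of_iso (HZiso kerEquiv _).symm) ((vanish_Z (n+1)).of_iso (HZiso kerEquiv _).symm)

lemma DD_comm_zero {G : Type} [CommGroup G] (S : Subgroup G) (t : G) :
    groupCohomology.map (A := Mo S) (B := Mo S) (MonoidHom.id G) (DD S t) 1 = 0 := by
  rw [← cancel_epi (H1π (Mo S)), Limits.comp_zero]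
  have := H1π_comp_map (A := Mo S) (B := Mo S) (MonoidHom.id G) (DD S t)
  refine this.trans ?_
  ext f : 2
  change H1π (Mo S) _ = 0
  rw [H1π_eq_zero_iff]
  refine ⟨f t, ?_⟩
  funext g
  apply Subtype.ext
  funext x
  have hf := (mem_cocycles₁_iff (A := Mo S) f.1).1 f.2
  have h1 := congrFun (congrArg Subtype.val (hf g t)) x
  have h2 := congrFun (congrArg Subtype.val (hf t g)) x
  rw [mul_comm t g] at h2
  change (f.1 (g * t)).1 x = (f.1 t).1 (x * g) + (f.1 g).1 x at h1
  change (f.1 (g * t)).1 x = (f.1 g).1 (x * t) + (f.1 t).1 x at h2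
  rw [mul_comm x t] at h2
  change (f.1 t).1 (x * g) - (f.1 t).1 x = (f.1 g).1 (t * x) - (f.1 g).1 x
  linarith

lemma H1Z : Nonempty (HZ (Multiplicative ℤ) 1 ≃+ ℤ) := by
  refine ⟨(H1IsoOfIsTrivial (Rep.trivial ℤ (Multiplicative ℤ) ℤ)).toLinearEquiv.toAddEquiv.trans ?_⟩
  exact (zmultiplesAddHom ℤ).symm

lemma H2Z2 : Nonempty (HZ Z2 2 ≃+ ℤ) := by
  obtain ⟨e⟩ := step pr (Multiplicative.ofAdd ![0, 1]) rfl 1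
    ((vanish_Z 0).of_iso (HZiso kerEquiv _).symm) (DD_comm_zero _ _)
  obtain ⟨e'⟩ := H1Z
  exact ⟨(e ≪≫ (HZiso kerEquiv _).symm).toLinearEquiv.toAddEquiv.trans e'⟩

lemma twoCocycle_conj {G : Type} [Group G] (S : Subgroup G) (c : G → G → G → ℤ)
    (hc : ∀ g h j x, c (g * h) j x + c g h x = c h j (x * g) + c g (h * j) x)
    (hs : ∀ g h x, ∀ s ∈ S, c g h (s * x) = c g h x)
    (t a b a₁ b₁ : G) (ha : t * a = a₁ * t) (hb : t * b = b₁ * t) (hab : a * b = b * a)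
    (hab₁ : a₁ * b₁ = b₁ * a₁) (haS : a₁ ∈ S) (hbS : b₁ ∈ S) :
    c a b t - c b a t = c a₁ b₁ 1 - c b₁ a₁ 1 := by
  have inv : ∀ g h s, s ∈ S → c g h s = c g h 1 := fun g h s h' => by
    have := hs g h 1 s h'
    rwa [mul_one] at this
  have e1 := hc t a b 1
  have e2 := hc t b a 1
  have e3 := hc a₁ t b 1
  have e4 := hc b₁ t a 1
  have e5 := hc a₁ b₁ t 1
  have e6 := hc b₁ a₁ t 1
  simp only [one_mul] at e1 e2 e3 e4 e5 e6
  rw [inv _ _ a₁ haS] at e3 e5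
  rw [inv _ _ b₁ hbS] at e4 e6
  rw [ha] at e1 e4
  rw [hb] at e2 e3
  rw [hab] at e1
  rw [hab₁] at e5
  linarith

lemma bilin_det (k : (Fin 2 → ℤ) → (Fin 2 → ℤ) → ℤ)
    (hk : ∀ x y z, k (x + y) z + k x y = k y z + k x (y + z)) (M : Matrix (Fin 2) (Fin 2) ℤ) :
    k (M.mulVec ![1, 0]) (M.mulVec ![0, 1]) - k (M.mulVec ![0, 1]) (M.mulVec ![1, 0]) =
      M.det * (k ![1, 0] ![0, 1] - k ![0, 1] ![1, 0]) := by
  have add : ∀ x y z, k (x + y) z - k z (x + y) = (k x z - k z x) + (k y z - k z y) := by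
    intro x y z
    have e1 := hk x y z
    have e2 := hk z x y
    have e3 := hk x z y
    rw [add_comm z x] at e2
    rw [add_comm z y] at e3
    linarith
  let L : (Fin 2 → ℤ) → (Fin 2 → ℤ) →+ ℤ := fun z =>
    AddMonoidHom.mk' (fun x => k x z - k z x) (fun x y => add x y z)
  have hL : ∀ x z, L z x = k x z - k z x := fun _ _ => rfl
  have hsw : ∀ x z, L z x = - L x z := fun x z => by rw [hL, hL]; ring
  have hex : ∀ v : Fin 2 → ℤ, v = v 0 • ![1, 0] + v 1 • ![0, 1] := fun v => by
    funext i; fin_cases i <;> simp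
  have hself : ∀ x, L x x = 0 := fun x => by rw [hL]; ring
  have gen : ∀ v w : Fin 2 → ℤ, L w v = (v 0 * w 1 - v 1 * w 0) * L ![0, 1] ![1, 0] := by
    intro v w
    have h1 : ∀ z, L z v = v 0 * L z ![1, 0] + v 1 * L z ![0, 1] := fun z => by
      conv_lhs => rw [hex v]
      rw [map_add, map_zsmul, map_zsmul, smul_eq_mul, smul_eq_mul]
    have h2 : ∀ z, L z w = w 0 * L z ![1, 0] + w 1 * L z ![0, 1] := fun z => by
      conv_lhs => rw [hex w]
      rw [map_add, map_zsmul, map_zsmul, smul_eq_mul, smul_eq_mul]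
    rw [h1, hsw _ w, hsw _ w, h2, h2, hself, hself, hsw ![0, 1] ![1, 0]]
    ring
  rw [← hL, ← hL, gen, Matrix.det_fin_two]
  simp [Matrix.mulVec, dotProduct, Fin.sum_univ_two]
  left; ring

lemma abs_lemma {Z H : Type} [AddCommGroup Z] [AddCommGroup H] (P : Z →+ H) (e : H ≃+ ℤ)
    (F : Z →+ ℤ) (hk : ∀ z, P z = 0 → F z = 0) (c : Z) (hc : F c = 1) (d : Z) (hd : F d = 0) :
    P d = 0 := by
  have h0 : P (e (P c) • d - e (P d) • c) = 0 := by
    apply e.injective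
    rw [map_sub, map_zsmul, map_zsmul, map_sub, map_zsmul, map_zsmul, map_zero,
      smul_eq_mul, smul_eq_mul]
    ring
  have h1 := hk _ h0
  rw [map_sub, map_zsmul, map_zsmul, hd, hc] at h1
  apply e.injective
  rw [map_zero]
  simpa using h1

section semi
variable (φ : Multiplicative ℤ →* MulAut Z2)

abbrev Gp := SemidirectProduct Z2 (Multiplicative ℤ) φ
abbrev ppi : Gp φ →* Multiplicative ℤ := SemidirectProduct.rightHom
abbrev tt : Gp φ := SemidirectProduct.inr (Multiplicative.ofAdd 1)

def kerE : (ppi φ).ker ≃* Z2 :=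
  ((MonoidHom.ofInjective (f := (SemidirectProduct.inl : Z2 →* Gp φ))
    SemidirectProduct.inl_injective).trans
    (MulEquiv.subgroupCongr SemidirectProduct.range_inl_eq_ker_rightHom)).symm

lemma inl_mem (v : Z2) : (SemidirectProduct.inl v : Gp φ) ∈ (ppi φ).ker := by
  rw [MonoidHom.mem_ker]; exact SemidirectProduct.rightHom_inl v

def rr (x : Gp φ) : Fin 2 → ℤ := x.left.toAdd

lemma rr_mul (s x : Gp φ) (hs : s ∈ (ppi φ).ker) : rr φ (s * x) = rr φ s + rr φ x := by
  have h : s.right = 1 := MonoidHom.mem_ker.1 hs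
  simp [rr, SemidirectProduct.mul_left, h]

def c0fun : Gp φ × Gp φ → Mo (ppi φ).ker := fun p => mkMo _
  (fun x => (rr φ (x * p.1) 0 - rr φ x 0) * (rr φ (x * p.1 * p.2) 1 - rr φ (x * p.1) 1))
  (fun s hs x => by
    simp only [mul_assoc, rr_mul φ s _ hs, Pi.add_apply]
    ring)

def c0 : cocycles₂ (Mo (ppi φ).ker) := ⟨c0fun φ, by
  rw [mem_cocycles₂_iff]
  intro g h j
  apply Subtype.ext
  funext x
  change (rr φ (x * (g * h)) 0 - rr φ x 0) * (rr φ (x * (g * h) * j) 1 - rr φ (x * (g * h)) 1)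
    + (rr φ (x * g) 0 - rr φ x 0) * (rr φ (x * g * h) 1 - rr φ (x * g) 1)
    = (rr φ (x * g * h) 0 - rr φ (x * g) 0) * (rr φ (x * g * h * j) 1 - rr φ (x * g * h) 1)
    + (rr φ (x * g) 0 - rr φ x 0) * (rr φ (x * g * (h * j)) 1 - rr φ (x * g) 1)
  simp only [← mul_assoc]
  ring⟩

def ea : Gp φ := SemidirectProduct.inl (Multiplicative.ofAdd ![1, 0])
def eb : Gp φ := SemidirectProduct.inl (Multiplicative.ofAdd ![0, 1])

lemma ea_eb : ea φ * eb φ = eb φ * ea φ := by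
  unfold ea eb
  rw [← map_mul SemidirectProduct.inl, ← map_mul SemidirectProduct.inl, mul_comm]

def Phi : (Gp φ × Gp φ → Mo (ppi φ).ker) →+ ℤ where
  toFun f := (f (ea φ, eb φ)).1 1 - (f (eb φ, ea φ)).1 1
  map_zero' := by change (0:ℤ) - 0 = 0; ring
  map_add' f f' := by
    change ((f (ea φ, eb φ)).1 1 + (f' (ea φ, eb φ)).1 1)
      - ((f (eb φ, ea φ)).1 1 + (f' (eb φ, ea φ)).1 1) = _
    ring

lemma Phi_apply (f : Gp φ × Gp φ → Mo (ppi φ).ker) :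
    Phi φ f = (f (ea φ, eb φ)).1 1 - (f (eb φ, ea φ)).1 1 := rfl

lemma Phi_c0 : Phi φ (c0fun φ) = 1 := by
  rw [Phi_apply]
  simp [c0fun, mkMo, ea, eb, rr]

lemma Phi_cob (f : Gp φ × Gp φ → Mo (ppi φ).ker) (hf : f ∈ coboundaries₂ (Mo (ppi φ).ker)) :
    Phi φ f = 0 := by
  obtain ⟨h, rfl⟩ := hf
  rw [Phi_apply]
  change ((h (eb φ)).1 (1 * ea φ) - (h (ea φ * eb φ)).1 1 + (h (ea φ)).1 1)
    - ((h (ea φ)).1 (1 * eb φ) - (h (eb φ * ea φ)).1 1 + (h (eb φ)).1 1) = 0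
  have h1 := Mo_inv (h (eb φ)) (ea φ) (inl_mem φ _) 1
  have h2 := Mo_inv (h (ea φ)) (eb φ) (inl_mem φ _) 1
  rw [mul_one] at h1 h2
  rw [one_mul, one_mul, h1, h2, ea_eb]
  ring

variable (M : Matrix (Fin 2) (Fin 2) ℤ)
  (hM : ∀ v : Fin 2 → ℤ, φ (Multiplicative.ofAdd 1) (Multiplicative.ofAdd v)
    = Multiplicative.ofAdd (M.mulVec v)) (hdet : M.det = 1)

include hM in
lemma conj_t (v : Fin 2 → ℤ) : tt φ * SemidirectProduct.inl (Multiplicative.ofAdd v)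
    = SemidirectProduct.inl (Multiplicative.ofAdd (M.mulVec v)) * tt φ := by
  rw [← hM, SemidirectProduct.inl_aut]
  simp [mul_assoc]

include hM hdet in
lemma Phi_D (f : cocycles₂ (Mo (ppi φ).ker)) :
    (f.1 (ea φ, eb φ)).1 (tt φ) - (f.1 (eb φ, ea φ)).1 (tt φ) =
      (f.1 (ea φ, eb φ)).1 1 - (f.1 (eb φ, ea φ)).1 1 := by
  have hf := (mem_cocycles₂_iff (A := Mo (ppi φ).ker) f.1).1 f.2
  have hc : ∀ g h j x, (f.1 (g * h, j)).1 x + (f.1 (g, h)).1 x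
      = (f.1 (h, j)).1 (x * g) + (f.1 (g, h * j)).1 x :=
    fun g h j x => congrFun (congrArg Subtype.val (hf g h j)) x
  have hs : ∀ g h x, ∀ s ∈ (ppi φ).ker, (f.1 (g, h)).1 (s * x) = (f.1 (g, h)).1 x :=
    fun g h x s hs => Mo_inv _ s hs x
  let i : (Fin 2 → ℤ) → Gp φ := fun v => SemidirectProduct.inl (Multiplicative.ofAdd v)
  have hi : ∀ v w, i (v + w) = i v * i w := fun v w => by
    simp only [i]; rw [ofAdd_add, map_mul]
  have hi' : ∀ v w, i v * i w = i w * i v := fun v w => by rw [← hi, ← hi, add_comm]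
  have key := twoCocycle_conj (ppi φ).ker (fun g h x => (f.1 (g, h)).1 x) hc hs (tt φ) (ea φ) (eb φ)
    (i (M.mulVec ![1, 0])) (i (M.mulVec ![0, 1])) (conj_t φ M hM _) (conj_t φ M hM _)
    (ea_eb φ) (hi' _ _) (inl_mem φ _) (inl_mem φ _)
  refine key.trans ?_
  have := bilin_det (fun v w => (f.1 (i v, i w)).1 1) (fun x y z => by
    have h := hc (i x) (i y) (i z) 1
    have h2 := hs (i y) (i z) 1 (i x) (inl_mem φ _)
    rw [mul_one] at h2
    rw [one_mul, h2] at h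
    rw [hi, hi]
    exact h) M
  rw [hdet, one_mul] at this
  exact this

lemma H2Mo : Nonempty (groupCohomology (Mo (ppi φ).ker) 2 ≃+ ℤ) := by
  obtain ⟨e⟩ := H2Z2
  exact ⟨(coindIso (Rep.trivial ℤ (ppi φ).ker ℤ) 2 ≪≫
    (HZiso (kerE φ) 2).symm).toLinearEquiv.toAddEquiv.trans e⟩

include hM hdet in
lemma DD_zero : groupCohomology.map (A := Mo (ppi φ).ker) (B := Mo (ppi φ).ker)
    (MonoidHom.id (Gp φ)) (DD (ppi φ).ker (tt φ)) 2 = 0 := by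
  rw [← cancel_epi (H2π (Mo (ppi φ).ker)), Limits.comp_zero]
  refine (H2π_comp_map (A := Mo (ppi φ).ker) (B := Mo (ppi φ).ker)
    (MonoidHom.id (Gp φ)) (DD (ppi φ).ker (tt φ))).trans ?_
  ext f : 2
  let d : cocycles₂ (Mo (ppi φ).ker) := mapCocycles₂ (A := Mo (ppi φ).ker)
    (B := Mo (ppi φ).ker) (MonoidHom.id (Gp φ)) (DD (ppi φ).ker (tt φ)) f
  change H2π (Mo (ppi φ).ker) d = 0
  have hd : Phi φ d.1 = 0 := by
    rw [Phi_apply]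
    change ((f.1 (ea φ, eb φ)).1 (tt φ * 1) - (f.1 (ea φ, eb φ)).1 1)
      - ((f.1 (eb φ, ea φ)).1 (tt φ * 1) - (f.1 (eb φ, ea φ)).1 1) = 0
    have := Phi_D φ M hM hdet f
    rw [mul_one]
    linarith
  obtain ⟨e⟩ := H2Mo φ
  exact abs_lemma (H2π (Mo (ppi φ).ker)).hom.toAddMonoidHom e
    ((Phi φ).comp (cocycles₂ (Mo (ppi φ).ker)).subtype.toAddMonoidHom)
    (fun z hz => Phi_cob φ _ ((H2π_eq_zero_iff z).1 hz)) (c0 φ) (Phi_c0 φ) d hd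

include hM hdet in
lemma final : Nonempty (HZ (Gp φ) 3 ≃+ ℤ) := by
  obtain ⟨e⟩ := step (ppi φ) (tt φ) (SemidirectProduct.rightHom_inr _) 2
    ((vanish_Z2 0).of_iso (HZiso (kerE φ) _).symm) (DD_zero φ M hM hdet)
  obtain ⟨e'⟩ := H2Z2
  exact ⟨(e ≪≫ (HZiso (kerE φ) 2).symm).toLinearEquiv.toAddEquiv.trans e'⟩

end semi

end TB

end

/-- If `det θ = 1`, then `H³(G, ℤ) ≅ ℤ`. -/
theorem torusBundle_H3_detOne (θ : GL (Fin 2) ℤ)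
    (hdet : (θ : Matrix (Fin 2) (Fin 2) ℤ).det = 1) :
    Nonempty ((groupCohomology (Rep.trivial ℤ (TorusBundleGroup θ) ℤ) 3) ≃+ ℤ) := by
  refine TB.final (torusAction θ) (θ : Matrix (Fin 2) (Fin 2) ℤ) (fun v => ?_) hdet
  have : torusAction θ (Multiplicative.ofAdd 1) = torusAut θ := by
    simp [torusAction]
  rw [this]
  rfl
end
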